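/- Let G be a finite simple graph with exactly t triangles in which every edge is contained in at most Δ triangles, with Δ ≥ 1. Then the set of triangles of G can be partitioned into at most 3Δ − 2 classes S₁, …, S_ℓ such that within each class the triangles are pairwise edge-disjoint and each class has size at least ⌊t/(3Δ − 2)⌋. -/

import Mathlib

section DirectedPaths

variable {κ : Type*} [DecidableEq κ] {R R' : κ → κ → Prop} {m a b : κ} {S T : Finset κ}

/-- There is a directed path of `R` from the given vertex to `m` that uses only vertices of the
given finset, each at most once. -/
inductive PathIn (R : κ → κ → Prop) (m : κ) : Finset κ → κ → Prop
  | refl {S : Finset κ} : m ∈ S → PathIn R m S m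
  | step {S : Finset κ} {a b : κ} : a ∈ S → R a b → PathIn R m (S.erase a) b → PathIn R m S a

namespace PathIn

theorem mem_source (h : PathIn R m S a) : a ∈ S := by
  cases h <;> assumption

theorem mem_target (h : PathIn R m S a) : m ∈ S := by
  induction h with
  | refl h => exact h
  | step _ _ _ ih => exact Finset.mem_of_mem_erase ih

theorem mono (h : PathIn R m S a) (hST : S ⊆ T) (hR : ∀ i ∈ S, ∀ j ∈ S, R i j → R' i j) :
    PathIn R' m T a := by
  induction h generalizing T with
  | refl h => exact .refl (hST h)
  | step ha hab h ih =>
    refine .step (hST ha) (hR _ ha _ (Finset.mem_of_mem_erase h.mem_source) hab)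
      (ih (Finset.erase_subset_erase _ hST) fun i hi j hj => ?_)
    exact hR i (Finset.mem_of_mem_erase hi) j (Finset.mem_of_mem_erase hj)

theorem mono_set (h : PathIn R m S a) (hST : S ⊆ T) : PathIn R m T a :=
  h.mono hST fun _ _ _ _ => id

/-- A path either avoids the vertex `a` or passes through it. -/
theorem erase_or (h : PathIn R m S b) (a : κ) : PathIn R m (S.erase a) b ∨ PathIn R m S a := by
  induction h with
  | refl h =>
    rcases eq_or_ne m a with rfl | hne
    · exact .inr (.refl h)
    · exact .inl (.refl (Finset.mem_erase.2 ⟨hne, h⟩))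
  | @step S c d hc hcd h ih =>
    rcases eq_or_ne c a with rfl | hne
    · exact .inr (.step hc hcd h)
    · rcases ih with ih | ih
      · refine .inl (.step (Finset.mem_erase.2 ⟨hne, hc⟩) hcd ?_)
        rwa [Finset.erase_right_comm]
      · exact .inr (ih.mono_set (Finset.erase_subset _ _))

theorem head (ha : a ∈ S) (hab : R a b) (h : PathIn R m S b) : PathIn R m S a := by
  rcases h.erase_or a with h | h
  · exact .step ha hab h
  · exact h

end PathIn

/-- If all vertices of a set reach `m` inside it, then there are a vertex `U` and a nonempty set `T`
of vertices that are not needed by the others to reach `m`, such that arcs leaving `T` inside the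
set end in `U`. -/
theorem exists_terminal_set {A : Finset κ} (hA : ∀ i ∈ A, PathIn R m A i) (hm : m ∈ A)
    (hcard : 2 ≤ A.card) :
    ∃ U ∈ A, ∃ T ⊆ A.erase U, T.Nonempty ∧
      (∀ W ∈ T, ∀ i ∈ A, i ≠ W → PathIn R m (A.erase W) i) ∧
      (∀ W ∈ T, ∀ i ∈ A, i ≠ U → i ∉ T → ¬ R W i) := by
  classical
  let F : κ → Finset κ := fun U => (A.erase U).filter fun i => ¬ PathIn R m (A.erase U) i
  have hF : ∀ U i, i ∈ F U ↔ (i ≠ U ∧ i ∈ A) ∧ ¬ PathIn R m (A.erase U) i := by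
    intro U i
    simp [F]
  have hne : (A.filter fun U => (F U).Nonempty).Nonempty := by
    obtain ⟨i, hi, him⟩ := Finset.exists_mem_ne (by omega : 1 < A.card) m
    refine ⟨m, Finset.mem_filter.2 ⟨hm, i, (hF m i).2 ⟨⟨him, hi⟩, fun h => ?_⟩⟩⟩
    simpa using h.mem_target
  obtain ⟨U, hU, hmin⟩ := Finset.exists_min_image _ (fun U => (F U).card) hne
  rw [Finset.mem_filter] at hU
  refine ⟨U, hU.1, F U, Finset.filter_subset _ _, hU.2, ?_, ?_⟩
  · intro W hW i hi hiW
    by_contra hcon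
    have hW' := (hF U W).1 hW
    have hWF : (F W).Nonempty := ⟨i, (hF W i).2 ⟨⟨hiW, hi⟩, hcon⟩⟩
    have hle := hmin W (Finset.mem_filter.2 ⟨hW'.1.2, hWF⟩)
    refine absurd hle (not_le.2 (Finset.card_lt_card ⟨?_, fun h => ?_⟩))
    · intro j hj
      have hj' := (hF W j).1 hj
      have avoid : ∀ l, PathIn R m (A.erase U) l → PathIn R m ((A.erase U).erase W) l :=
        fun l hl => (hl.erase_or W).resolve_right hW'.2
      refine (hF U j).2 ⟨⟨?_, hj'.1.2⟩, fun hp => hj'.2 ?_⟩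
      · rintro rfl
        apply hj'.2
        cases hA j hj'.1.2 with
        | refl h => exact .refl (Finset.mem_erase.2 ⟨hj'.1.1, h⟩)
        | step h hab hp =>
          refine .step (Finset.mem_erase.2 ⟨hj'.1.1, h⟩) hab ?_
          rw [Finset.erase_right_comm]
          exact avoid _ hp
      · exact (avoid j hp).mono_set (Finset.erase_subset_erase _ (Finset.erase_subset _ _))
    · have := (hF W W).1 (h hW)
      exact this.1.1 rfl
  · intro W hW i hi hiU hiF hR
    have hW' := (hF U W).1 hW
    have hp : PathIn R m (A.erase U) i := by
      by_contra hcon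
      exact hiF ((hF U i).2 ⟨⟨hiU, hi⟩, hcon⟩)
    exact hW'.2 (.head (Finset.mem_erase.2 ⟨hW'.1.1, hW'.1.2⟩) hR hp)

end DirectedPaths

section Coloring

open scoped Classical in
/-- The number of vertices of `X` with color `i`. -/
noncomputable def classSize {V κ : Type*} (X : Finset V) (c : V → κ) (i : κ) : ℕ :=
  (X.filter fun v => c v = i).card

/-- Adjacent vertices of `X` have different colors. -/
def ProperOn {V κ : Type*} (G : SimpleGraph V) (X : Finset V) (c : V → κ) : Prop :=
  ∀ v ∈ X, ∀ w ∈ X, G.Adj v w → c v ≠ c w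

/-- The vertex `v` has no neighbor in `X` of color `i`. -/
def Movable {V κ : Type*} (G : SimpleGraph V) (X : Finset V) (c : V → κ) (v : V) (i : κ) : Prop :=
  ∀ w ∈ X, c w = i → ¬ G.Adj v w

/-- Some vertex of color `a` has no neighbor of color `b`. -/
def ClassArc {V κ : Type*} (G : SimpleGraph V) (X : Finset V) (c : V → κ) (a b : κ) : Prop :=
  ∃ y ∈ X, c y = a ∧ Movable G X c y b

open scoped Classical in
/-- The number of neighbors of `v` in `X`. -/
noncomputable def degreeIn {V : Type*} (G : SimpleGraph V) (X : Finset V) (v : V) : ℕ :=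
  (X.filter fun w => G.Adj v w).card

open scoped Classical in
/-- The number of neighbors of `v` in `X` of color `i`. -/
noncomputable def colorDegree {V κ : Type*} (G : SimpleGraph V) (X : Finset V) (c : V → κ) (v : V)
    (i : κ) : ℕ :=
  (X.filter fun w => G.Adj v w ∧ c w = i).card

variable {V κ : Type*} {G : SimpleGraph V} {X : Finset V} {c : V → κ} {K : Finset κ}

theorem sum_colorDegree_of_mapsTo [DecidableEq κ] {Y : Finset V} (hK : ∀ v ∈ Y, c v ∈ K) (v : V) :
    ∑ i ∈ K, colorDegree G Y c v i = degreeIn G Y v := by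
  classical
  unfold colorDegree degreeIn
  rw [Finset.card_eq_sum_card_fiberwise (f := c) (t := K)]
  · refine Finset.sum_congr rfl fun i _ => ?_
    congr 1
    ext w
    simp [and_assoc]
  · intro w hw
    exact hK w (Finset.mem_of_mem_filter w hw)

theorem one_le_colorDegree {v : V} {i : κ} (h : ¬ Movable G X c v i) :
    1 ≤ colorDegree G X c v i := by
  classical
  unfold Movable at h
  push Not at h
  obtain ⟨w, hw, hwi, hvw⟩ := h
  exact Finset.card_pos.2 ⟨w, Finset.mem_filter.2 ⟨hw, hvw, hwi⟩⟩

theorem exists_movable (hK : ∀ v ∈ X, c v ∈ K) {v : V} (h : degreeIn G X v < K.card) :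
    ∃ i ∈ K, Movable G X c v i := by
  classical
  by_contra! hcon
  have h1 : ∑ i ∈ K, 1 ≤ ∑ i ∈ K, colorDegree G X c v i :=
    Finset.sum_le_sum fun i hi => one_le_colorDegree (hcon i hi)
  rw [sum_colorDegree_of_mapsTo hK] at h1
  simp at h1
  omega

theorem degreeIn_mono {Y : Finset V} (h : Y ⊆ X) (v : V) : degreeIn G Y v ≤ degreeIn G X v := by
  classical
  exact Finset.card_le_card (Finset.filter_subset_filter _ h)

theorem degreeIn_mono_graph {G' : SimpleGraph V} (h : G' ≤ G) (X : Finset V) (v : V) :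
    degreeIn G' X v ≤ degreeIn G X v := by
  classical
  exact Finset.card_le_card (Finset.monotone_filter_right _ fun _ _ hw => h hw)

theorem ProperOn.mono {Y : Finset V} (h : ProperOn G X c) (hY : Y ⊆ X) : ProperOn G Y c :=
  fun v hv w hw => h v (hY hv) w (hY hw)

theorem classSize_erase [DecidableEq V] [DecidableEq κ] {z : V} (hz : z ∈ X) (i : κ) :
    classSize (X.erase z) c i + (if i = c z then 1 else 0) = classSize X c i := by
  classical
  unfold classSize
  rw [Finset.filter_erase]
  split_ifs with h
  · rw [Finset.card_erase_add_one]
    simp [hz, h]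
  · rw [Finset.erase_eq_of_notMem, add_zero]
    simp [hz, Ne.symm h]

theorem classSize_eq_card [DecidableEq κ] (i : κ) :
    classSize X c i = (X.filter fun v => c v = i).card := by
  unfold classSize
  congr

theorem classSize_congr {c' : V → κ} {i : κ} (h : ∀ v ∈ X, c v = i ↔ c' v = i) :
    classSize X c i = classSize X c' i := by
  classical
  unfold classSize
  congr 1
  exact Finset.filter_congr h

section Update

variable [DecidableEq V] {z : V} {i : κ}

theorem ProperOn.update (h : ProperOn G (X.erase z) c) (hi : Movable G (X.erase z) c z i) :
    ProperOn G X (Function.update c z i) := by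
  intro v hv w hw hvw
  rcases eq_or_ne v z with rfl | hvz
  · have hwv : w ≠ v := hvw.ne'
    rw [Function.update_self, Function.update_of_ne hwv]
    exact fun he => hi w (Finset.mem_erase.2 ⟨hwv, hw⟩) he.symm hvw
  · rw [Function.update_of_ne hvz]
    rcases eq_or_ne w z with rfl | hwz
    · rw [Function.update_self]
      exact fun he => hi v (Finset.mem_erase.2 ⟨hvz, hv⟩) he hvw.symm
    · rw [Function.update_of_ne hwz]
      exact h v (Finset.mem_erase.2 ⟨hvz, hv⟩) w (Finset.mem_erase.2 ⟨hwz, hw⟩) hvw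

theorem classSize_update [DecidableEq κ] (hz : z ∈ X) (j : κ) :
    classSize X (Function.update c z i) j =
      classSize (X.erase z) c j + if j = i then 1 else 0 := by
  rw [← classSize_erase hz, Function.update_self]
  congr 1
  refine classSize_congr fun v hv => ?_
  rw [Function.update_of_ne (Finset.ne_of_mem_erase hv)]

end Update

/-- Moving one vertex along each arc of a path of color classes shrinks the first class by one
vertex and enlarges the last one. -/
theorem exists_shift [DecidableEq κ] {m p : κ} {S : Finset κ} (hc : ProperOn G X c)
    (h : PathIn (ClassArc G X c) m S p) :
    ∃ c' : V → κ, ProperOn G X c' ∧ (∀ v ∈ X, c v ∉ S → c' v = c v) ∧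
      (∀ v ∈ X, c v ∈ S → c' v ∈ S) ∧ (∀ v ∈ X, c' v = p → c v = p) ∧
      ∀ i, classSize X c' i + (if i = p then 1 else 0) =
        classSize X c i + if i = m then 1 else 0 := by
  classical
  induction h with
  | refl h => exact ⟨c, hc, by simp, by simp, by simp, by simp⟩
  | @step S a b ha hab h ih =>
    obtain ⟨c', hc', hout, hin, hstart, hsize⟩ := ih
    obtain ⟨y, hy, rfl, hyb⟩ := hab
    have hbS := h.mem_source
    have hback : ∀ v ∈ X, c' v = c y → c v = c y := by
      intro v hv hvy
      by_cases hvS : c v ∈ S.erase (c y)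
      · have := hin v hv hvS
        rw [hvy] at this
        simp at this
      · rw [← hout v hv hvS, hvy]
    have hcy : c' y = c y := hout y hy (by simp)
    refine ⟨Function.update c' y b, ?_, ?_, ?_, ?_, ?_⟩
    · refine (hc'.mono (Finset.erase_subset _ _)).update fun w hw hwb => ?_
      have hw := Finset.mem_of_mem_erase hw
      exact hyb w hw (hstart w hw hwb)
    · intro v hv hvS
      have hvy : v ≠ y := by
        rintro rfl
        exact hvS ha
      rw [Function.update_of_ne hvy]
      exact hout v hv fun h => hvS (Finset.mem_of_mem_erase h)
    · intro v hv hvS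
      rcases eq_or_ne v y with rfl | hvy
      · rw [Function.update_self]
        exact Finset.mem_of_mem_erase hbS
      · rw [Function.update_of_ne hvy]
        by_cases hvc : c v = c y
        · rwa [hout v hv (by simp [hvc])]
        · exact Finset.mem_of_mem_erase (hin v hv (Finset.mem_erase.2 ⟨hvc, hvS⟩))
    · intro v hv hvy
      rcases eq_or_ne v y with rfl | hne
      · rfl
      · rw [Function.update_of_ne hne] at hvy
        exact hback v hv hvy
    · intro i
      have h1 := hsize i
      have h2 := classSize_erase (c := c') hy i
      rw [hcy] at h2
      rw [classSize_update hy]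
      omega

/-- A proper coloring of a subset of `X` extends greedily to `X`. -/
theorem exists_proper_extension {X₀ : Finset V} (hX : X₀ ⊆ X)
    (hdeg : ∀ v ∈ X, degreeIn G X v < K.card) (hcK : ∀ v ∈ X₀, c v ∈ K) (hc : ProperOn G X₀ c) :
    ∃ c' : V → κ, (∀ v ∈ X, c' v ∈ K) ∧ ProperOn G X c' ∧ ∀ v ∈ X₀, c' v = c v := by
  classical
  induction hn : (X \ X₀).card generalizing X₀ c with
  | zero =>
    have : X = X₀ := (Finset.sdiff_eq_empty_iff_subset.1 (Finset.card_eq_zero.1 hn)).antisymm hX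
    subst this
    exact ⟨c, hcK, hc, fun _ _ => rfl⟩
  | succ n ih =>
    obtain ⟨z, hz⟩ := Finset.card_pos.1 (show 0 < (X \ X₀).card by omega)
    obtain ⟨hzX, hzX₀⟩ := Finset.mem_sdiff.1 hz
    obtain ⟨i, hi, hmov⟩ := exists_movable hcK ((degreeIn_mono (G := G) hX z).trans_lt (hdeg z hzX))
    have hne : ∀ v ∈ X₀, v ≠ z := by
      rintro v hv rfl
      exact hzX₀ hv
    have herase : (insert z X₀).erase z = X₀ := Finset.erase_insert hzX₀
    obtain ⟨c', hc'K, hc', hagree⟩ := ih (X₀ := insert z X₀) (c := Function.update c z i)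
      (Finset.insert_subset hzX hX)
      (fun v hv => by
        rcases Finset.mem_insert.1 hv with rfl | hv
        · rwa [Function.update_self]
        · rw [Function.update_of_ne (hne v hv)]
          exact hcK v hv)
      (ProperOn.update (by rwa [herase]) (by rwa [herase]))
      (by rw [Finset.sdiff_insert, Finset.card_erase_of_mem hz, hn, Nat.add_sub_cancel])
    refine ⟨c', hc'K, hc', fun v hv => ?_⟩
    rw [hagree v (Finset.mem_insert_of_mem hv), Function.update_of_ne (hne v hv)]

end Coloring

section HajnalSzemeredi

/-- A proper coloring of `X` with all classes of size `s`, except that class `m` lacks one vertex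
and class `p` has an extra one (if `m = p` there is no exception), together with a set `A` of color
classes from which vertices can be shifted to class `m` inside `A`. -/
structure NearlyEquitable {V κ : Type*} [DecidableEq κ] (G : SimpleGraph V) (X : Finset V)
    (K : Finset κ) (s : ℕ) (c : V → κ) (p m : κ) (A : Finset κ) : Prop where
  mapsTo : ∀ v ∈ X, c v ∈ K
  proper : ProperOn G X c
  large_mem : p ∈ K
  size : ∀ i ∈ K, classSize X c i + (if i = m then 1 else 0) = s + if i = p then 1 else 0
  subset : A ⊆ K
  small_mem : m ∈ A
  path : ∀ i ∈ A, PathIn (ClassArc G X c) m A i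

/-- `X` has a proper coloring with color set `K` and all classes of size `s`. -/
def EquitablyColorable {V κ : Type*} (G : SimpleGraph V) (X : Finset V) (K : Finset κ) (s : ℕ) :
    Prop :=
  ∃ c : V → κ, (∀ v ∈ X, c v ∈ K) ∧ ProperOn G X c ∧ ∀ i ∈ K, classSize X c i = s

/-- The vertex `z` is the only neighbor of `y` in its color class. -/
def Solo {V κ : Type*} (G : SimpleGraph V) (X : Finset V) (c : V → κ) (z y : V) : Prop :=
  G.Adj y z ∧ ∀ w ∈ X, c w = c z → G.Adj y w → w = z

variable {V κ : Type*} [DecidableEq κ] {G : SimpleGraph V} {X : Finset V}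
  {c : V → κ} {K A : Finset κ} {s : ℕ} {p m : κ}

theorem sum_colorDegree_add_degreeIn (A : Finset κ) (v : V) :
    ∑ i ∈ A, colorDegree G X c v i + degreeIn G (X.filter fun w => c w ∉ A) v =
      degreeIn G X v := by
  classical
  have h := sum_colorDegree_of_mapsTo (G := G) (c := c) (K := A) (Y := X.filter fun w => c w ∈ A)
    (fun w hw => (Finset.mem_filter.1 hw).2) v
  have h2 : ∀ i ∈ A, colorDegree G (X.filter fun w => c w ∈ A) c v i = colorDegree G X c v i := by
    intro i hi
    unfold colorDegree
    congr 1
    ext w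
    simp only [Finset.mem_filter]
    grind
  rw [Finset.sum_congr rfl h2] at h
  rw [h]
  unfold degreeIn
  rw [← Finset.card_filter_add_card_filter_not (s := X.filter fun w => G.Adj v w)
    (fun w => c w ∈ A)]
  simp only [Finset.filter_filter, and_comm]

theorem sum_classSize (A : Finset κ) :
    ∑ i ∈ A, classSize X c i = (X.filter fun w => c w ∈ A).card := by
  classical
  rw [Finset.card_eq_sum_card_fiberwise (f := c) (t := A)]
  · refine Finset.sum_congr rfl fun i hi => ?_
    unfold classSize
    congr 1
    ext w
    simp only [Finset.mem_filter]
    grind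
  · intro w hw
    exact (Finset.mem_filter.1 hw).2

open scoped Classical in
theorem sum_sum_adj (Y Z : Finset V) (f : V → ℕ) :
    ∑ y ∈ Y, ∑ z ∈ Z.filter (fun z => G.Adj y z), f z = ∑ z ∈ Z, f z * degreeIn G Y z := by
  rw [Finset.sum_comm' (t' := Z) (s' := fun z => Y.filter fun y => G.Adj z y)]
  · refine Finset.sum_congr rfl fun z _ => ?_
    rw [Finset.sum_const, smul_eq_mul, mul_comm]
    rfl
  · intro y z
    simp only [Finset.mem_filter, G.adj_comm]
    tauto

namespace NearlyEquitable

theorem card_outside (h : NearlyEquitable G X K s c p m A) (hp : p ∉ A) :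
    (X.filter fun w => c w ∉ A).card = (K \ A).card * s + 1 := by
  classical
  have h1 : (X.filter fun w => c w ∉ A) = X.filter fun w => c w ∈ K \ A := by
    refine Finset.filter_congr fun w hw => ?_
    simp [h.mapsTo w hw]
  rw [h1, ← sum_classSize]
  have h2 : ∀ i ∈ K \ A, classSize X c i = s + if i = p then 1 else 0 := by
    intro i hi
    rw [Finset.mem_sdiff] at hi
    have := h.size i hi.1
    rwa [if_neg, add_zero] at this
    rintro rfl
    exact hi.2 h.small_mem
  rw [Finset.sum_congr rfl h2, Finset.sum_add_distrib]
  simp [h.large_mem, hp]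

theorem card_sdiff_add (h : NearlyEquitable G X K s c p m A) : (K \ A).card + A.card = K.card :=
  Finset.card_sdiff_add_card_eq_card h.subset

theorem equitablyColorable (h : NearlyEquitable G X K s c p m A) (hp : p ∈ A) :
    EquitablyColorable G X K s := by
  obtain ⟨c', hc', hout, hin, -, hsize⟩ := exists_shift h.proper (h.path p hp)
  refine ⟨c', fun v hv => ?_, hc', fun i hi => ?_⟩
  · by_cases hvA : c v ∈ A
    · exact h.subset (hin v hv hvA)
    · rw [hout v hv hvA]
      exact h.mapsTo v hv
  · have h1 := hsize i
    have h2 := h.size i hi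
    omega

theorem degreeIn_outside_lt (h : NearlyEquitable G X K s c p m A)
    (hdeg : ∀ v ∈ X, degreeIn G X v < K.card)
    (hclosed : ∀ v ∈ X, c v ∉ A → ∀ i ∈ A, ¬ Movable G X c v i) {y : V} (hy : y ∈ X)
    (hyA : c y ∉ A) : degreeIn G (X.filter fun w => c w ∉ A) y < (K \ A).card := by
  have hcard := h.card_sdiff_add
  have h1 := hdeg y hy
  rw [← sum_colorDegree_add_degreeIn (c := c) A y] at h1
  have h2 : ∑ i ∈ A, 1 ≤ ∑ i ∈ A, colorDegree G X c y i :=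
    Finset.sum_le_sum fun i hi => one_le_colorDegree (hclosed y hy hyA i hi)
  rw [← Finset.card_eq_sum_ones] at h2
  omega

theorem two_le_card (h : NearlyEquitable G X K s c p m A) (hp : p ∉ A)
    (hdeg : ∀ v ∈ X, degreeIn G X v < K.card)
    (hclosed : ∀ v ∈ X, c v ∉ A → ∀ i ∈ A, ¬ Movable G X c v i) : 2 ≤ A.card := by
  classical
  by_contra! hlt
  have hpos : 0 < A.card := Finset.card_pos.2 ⟨m, h.small_mem⟩
  have hcard := h.card_sdiff_add
  have hout := h.card_outside hp
  have hms := h.size m (h.subset h.small_mem)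
  rw [if_pos rfl, if_neg (by rintro rfl; exact hp h.small_mem)] at hms
  have hsum := sum_sum_adj (G := G) (X.filter fun w => c w ∉ A) (X.filter fun w => c w = m)
    (fun _ => 1)
  have hl : (X.filter fun w => c w ∉ A).card ≤ ∑ y ∈ X.filter (fun w => c w ∉ A),
      ∑ z ∈ (X.filter fun w => c w = m).filter (fun z => G.Adj y z), 1 := by
    rw [Finset.card_eq_sum_ones]
    refine Finset.sum_le_sum fun y hy => ?_
    rw [Finset.mem_filter] at hy
    have := one_le_colorDegree (hclosed y hy.1 hy.2 m h.small_mem)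
    rw [← Finset.card_eq_sum_ones, Finset.filter_filter]
    simpa only [colorDegree, and_comm] using this
  have hr : ∑ z ∈ X.filter (fun w => c w = m), 1 * degreeIn G (X.filter fun w => c w ∉ A) z ≤
      ∑ z ∈ X.filter (fun w => c w = m), (K \ A).card := by
    refine Finset.sum_le_sum fun z hz => ?_
    rw [Finset.mem_filter] at hz
    have h1 := hdeg z hz.1
    have h2 := degreeIn_mono (G := G) (Finset.filter_subset (fun w => c w ∉ A) X) z
    omega
  rw [Finset.sum_const, smul_eq_mul, ← classSize_eq_card] at hr
  have hle : classSize X c m * (K \ A).card ≤ s * (K \ A).card :=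
    Nat.mul_le_mul_right _ (by omega)
  rw [mul_comm s] at hle
  omega

/-- If no solo vertex of the class `W` is movable, then there are more terminal classes in `T` than
classes outside `A`. -/
theorem card_outside_lt (h : NearlyEquitable G X K s c p m A) (hp : p ∉ A)
    (hdeg : ∀ v ∈ X, degreeIn G X v < K.card)
    (hclosed : ∀ v ∈ X, c v ∉ A → ∀ i ∈ A, ¬ Movable G X c v i)
    {U W : κ} {T : Finset κ} (hU : U ∈ A) (hT : T ⊆ A.erase U) (hW : W ∈ T) (hWm : W ≠ m)
    (harc : ∀ i ∈ A, i ≠ U → i ∉ T → ¬ ClassArc G X c W i)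
    (hsolo : ∀ z ∈ X, c z = W → ∀ y ∈ X, c y ∉ A → Solo G X c z y →
      ∀ i ∈ A, i ≠ W → ¬ Movable G X c z i) :
    (K \ A).card < T.card := by
  classical
  by_contra! hle
  have hWA : W ∈ A := Finset.mem_of_mem_erase (hT hW)
  have hcard := h.card_sdiff_add
  have hout := h.card_outside hp
  have hWs := h.size W (h.subset hWA)
  rw [if_neg hWm, if_neg (by rintro rfl; exact hp hWA), add_zero, add_zero] at hWs
  have hTc := Finset.card_le_card hT
  rw [Finset.card_erase_of_mem hU] at hTc
  have hApos : 0 < A.card := Finset.card_pos.2 ⟨U, hU⟩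
  set B := X.filter fun w => c w ∉ A with hB
  let f : V → ℕ := fun z => if ∃ y ∈ B, Solo G X c z y then 2 else 1
  have hsum := sum_sum_adj (G := G) B (X.filter fun w => c w = W) f
  have hl : ∑ y ∈ B, 2 ≤ ∑ y ∈ B,
      ∑ z ∈ (X.filter fun w => c w = W).filter (fun z => G.Adj y z), f z := by
    refine Finset.sum_le_sum fun y hy => ?_
    have hy' := Finset.mem_filter.1 hy
    have h1 := one_le_colorDegree (hclosed y hy'.1 hy'.2 W hWA)
    have heq : ((X.filter fun w => c w = W).filter fun z => G.Adj y z).card =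
        colorDegree G X c y W := by
      rw [Finset.filter_filter]
      simp only [colorDegree, and_comm]
    rcases h1.eq_or_lt with h1 | h1
    · rw [← h1, Finset.card_eq_one] at heq
      obtain ⟨z, hz⟩ := heq
      have hz' : z ∈ (X.filter fun w => c w = W).filter fun z => G.Adj y z := by
        rw [hz]
        exact Finset.mem_singleton_self z
      simp only [Finset.mem_filter] at hz'
      rw [hz, Finset.sum_singleton]
      have : ∃ y ∈ B, Solo G X c z y := by
        refine ⟨y, hy, hz'.2, fun w hw hwz hyw => ?_⟩
        rw [← Finset.mem_singleton, ← hz]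
        simp only [Finset.mem_filter]
        exact ⟨⟨hw, hwz.trans hz'.1.2⟩, hyw⟩
      simp only [f, if_pos this, le_refl]
    · calc 2 ≤ colorDegree G X c y W := h1
        _ = ∑ z ∈ (X.filter fun w => c w = W).filter (fun z => G.Adj y z), 1 := by
          rw [← heq, Finset.card_eq_sum_ones]
        _ ≤ _ := Finset.sum_le_sum fun z _ => by
          dsimp only [f]
          split_ifs <;> norm_num
  have hr : ∑ z ∈ X.filter (fun w => c w = W), f z * degreeIn G B z ≤
      ∑ z ∈ X.filter (fun w => c w = W), 2 * (K \ A).card := by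
    refine Finset.sum_le_sum fun z hz => ?_
    rw [Finset.mem_filter] at hz
    have h1 := hdeg z hz.1
    rw [← sum_colorDegree_add_degreeIn (c := c) A z, ← hB] at h1
    dsimp only [f]
    split_ifs with hs
    · obtain ⟨y, hy, hzy⟩ := hs
      have hy' := Finset.mem_filter.1 hy
      have h2 : ∑ i ∈ A.erase W, 1 ≤ ∑ i ∈ A, colorDegree G X c z i := by
        refine (Finset.sum_le_sum fun i hi => ?_).trans
          (Finset.sum_le_sum_of_subset (Finset.erase_subset W A))
        have hi' := Finset.mem_erase.1 hi
        exact one_le_colorDegree (hsolo z hz.1 hz.2 y hy'.1 hy'.2 hzy i hi'.2 hi'.1)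
      rw [← Finset.card_eq_sum_ones, Finset.card_erase_of_mem hWA] at h2
      omega
    · have h2 : ∑ i ∈ (A.erase U) \ T, 1 ≤ ∑ i ∈ A, colorDegree G X c z i := by
        refine (Finset.sum_le_sum fun i hi => ?_).trans (Finset.sum_le_sum_of_subset
          (Finset.sdiff_subset.trans (Finset.erase_subset U A)))
        have hi' := Finset.mem_sdiff.1 hi
        have hi'' := Finset.mem_erase.1 hi'.1
        exact one_le_colorDegree fun hmov =>
          harc i hi''.2 hi''.1 hi'.2 ⟨z, hz.1, hz.2, hmov⟩
      rw [← Finset.card_eq_sum_ones, Finset.card_sdiff_of_subset hT,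
        Finset.card_erase_of_mem hU] at h2
      omega
  rw [Finset.sum_const, smul_eq_mul, ← classSize_eq_card, hWs] at hr
  rw [Finset.sum_const, smul_eq_mul, hout] at hl
  nlinarith

open scoped Classical in
/-- A vertex outside `A` has many solo neighbors in the classes of `T`. -/
theorem le_card_solo (h : NearlyEquitable G X K s c p m A)
    (hdeg : ∀ v ∈ X, degreeIn G X v < K.card)
    (hclosed : ∀ v ∈ X, c v ∉ A → ∀ i ∈ A, ¬ Movable G X c v i)
    {T : Finset κ} (hT : T ⊆ A) {y : V} (hy : y ∈ X) (hyA : c y ∉ A) :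
    T.card + 1 + degreeIn G (X.filter fun w => c w ∉ A) y ≤
      ((X.filter fun w => c w ∈ T).filter fun z => Solo G X c z y).card + (K \ A).card := by
  have hcard := h.card_sdiff_add
  have h1 := hdeg y hy
  rw [← sum_colorDegree_add_degreeIn (c := c) A y] at h1
  have h2 : ∑ i ∈ A, (1 + if i ∈ T then 1 else 0) ≤
      ∑ i ∈ A, (colorDegree G X c y i +
        if i ∈ T ∧ colorDegree G X c y i = 1 then 1 else 0) := by
    refine Finset.sum_le_sum fun i hi => ?_
    have := one_le_colorDegree (hclosed y hy hyA i hi)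
    split_ifs <;> grind
  rw [Finset.sum_add_distrib, Finset.sum_add_distrib, ← Finset.card_eq_sum_ones,
    ← Finset.card_filter, ← Finset.card_filter, Finset.filter_mem_eq_inter,
    Finset.inter_eq_right.2 hT] at h2
  have h3 : (A.filter fun i => i ∈ T ∧ colorDegree G X c y i = 1) ⊆
      ((X.filter fun w => c w ∈ T).filter fun z => Solo G X c z y).image c := by
    intro i hi
    simp only [Finset.mem_filter] at hi
    obtain ⟨-, hiT, hi1⟩ := hi
    obtain ⟨z, hz⟩ := Finset.card_eq_one.1 hi1
    have hz' : ∀ w, (w ∈ X ∧ G.Adj y w ∧ c w = i) ↔ w = z := fun w => by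
      simpa using Finset.ext_iff.1 hz w
    obtain ⟨hzX, hyz, rfl⟩ := (hz' z).2 rfl
    refine Finset.mem_image.2 ⟨z, ?_, rfl⟩
    simp only [Finset.mem_filter]
    exact ⟨⟨hzX, hiT⟩, hyz, fun w hw hwz hyw => (hz' w).1 ⟨hw, hyw, hwz⟩⟩
  have h4 := (Finset.card_le_card h3).trans Finset.card_image_le
  omega

/-- Some vertex of a terminal class is solo and either movable or has two nonadjacent special
neighbors. -/
theorem exists_solo (h : NearlyEquitable G X K s c p m A) (hp : p ∉ A)
    (hdeg : ∀ v ∈ X, degreeIn G X v < K.card)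
    (hclosed : ∀ v ∈ X, c v ∉ A → ∀ i ∈ A, ¬ Movable G X c v i) :
    ∃ z ∈ X, c z ∈ A ∧ (∀ i ∈ A, i ≠ c z → PathIn (ClassArc G X c) m (A.erase (c z)) i) ∧
      c z ≠ m ∧ ∃ y ∈ X, c y ∉ A ∧ Solo G X c z y ∧
        ((∃ i ∈ A, i ≠ c z ∧ Movable G X c z i) ∨
          (∀ i ∈ A, i ≠ c z → ¬ Movable G X c z i) ∧
            ∃ y' ∈ X, c y' ∉ A ∧ Solo G X c z y' ∧ y ≠ y' ∧ ¬ G.Adj y y') := by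
  classical
  obtain ⟨U, hU, T, hT, hTne, hterm, harc⟩ :=
    exists_terminal_set h.path h.small_mem (h.two_le_card hp hdeg hclosed)
  have hTA : T ⊆ A := hT.trans (Finset.erase_subset _ _)
  have hTm : ∀ W ∈ T, W ≠ m := by
    rintro W hW rfl
    have := (hterm W hW U hU (Finset.ne_of_mem_erase (hT hW)).symm).mem_target
    simp at this
  by_contra hcon
  have hmov : ∀ z ∈ X, c z ∈ T → ∀ y ∈ X, c y ∉ A → Solo G X c z y →
      ∀ i ∈ A, i ≠ c z → ¬ Movable G X c z i := fun z hz hzT y hy hyA hzy i hi hiz hm =>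
    hcon ⟨z, hz, hTA hzT, hterm _ hzT, hTm _ hzT, y, hy, hyA, hzy, .inl ⟨i, hi, hiz, hm⟩⟩
  have hclique : ∀ z ∈ X, c z ∈ T → ∀ y ∈ X, c y ∉ A → Solo G X c z y →
      ∀ y' ∈ X, c y' ∉ A → Solo G X c z y' → y ≠ y' → G.Adj y y' := by
    intro z hz hzT y hy hyA hzy y' hy' hyA' hzy' hne
    by_contra hadj
    exact hcon ⟨z, hz, hTA hzT, hterm _ hzT, hTm _ hzT, y, hy, hyA, hzy,
      .inr ⟨hmov z hz hzT y hy hyA hzy, y', hy', hyA', hzy', hne, hadj⟩⟩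
  obtain ⟨W, hW⟩ := hTne
  have hlt : (K \ A).card < T.card :=
    h.card_outside_lt hp hdeg hclosed hU hT hW (hTm W hW) (harc W hW)
      fun z hz hzW y hy hyA hzy i hi hiW =>
        hmov z hz (hzW ▸ hW) y hy hyA hzy i hi (hzW ▸ hiW)
  have hcard := h.card_sdiff_add
  have hqpos : 0 < (K \ A).card :=
    Finset.card_pos.2 ⟨p, Finset.mem_sdiff.2 ⟨h.large_mem, hp⟩⟩
  have hout := h.card_outside hp
  have hZ : (X.filter fun w => c w ∈ T).card = T.card * s := by
    rw [← sum_classSize, Finset.sum_congr rfl (g := fun _ => s), Finset.sum_const, smul_eq_mul]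
    intro i hi
    have := h.size i (h.subset (hTA hi))
    rwa [if_neg (hTm i hi), if_neg (by rintro rfl; exact hp (hTA hi)), add_zero,
      add_zero] at this
  have hsol : ∀ y ∈ X.filter (fun w => c w ∉ A), _ := fun y hy =>
    h.le_card_solo hdeg hclosed hTA (Finset.mem_filter.1 hy).1 (Finset.mem_filter.1 hy).2
  have hdB : ∀ y ∈ X.filter (fun w => c w ∉ A),
      degreeIn G (X.filter fun w => c w ∉ A) y + 1 ≤ (K \ A).card := fun y hy =>
    h.degreeIn_outside_lt hdeg hclosed (Finset.mem_filter.1 hy).1 (Finset.mem_filter.1 hy).2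
  set B := X.filter fun w => c w ∉ A with hB
  set Z := X.filter fun w => c w ∈ T with hZdef
  set q := (K \ A).card with hq
  let σ : V → ℕ := fun z => (B.filter fun y => Solo G X c z y).card
  have hσ : ∀ y ∈ B, ∀ z ∈ Z, Solo G X c z y → 0 < σ z ∧ σ z ≤ degreeIn G B y + 1 := by
    intro y hy z hz hzy
    have hy' := Finset.mem_filter.1 hy
    have hz' := Finset.mem_filter.1 hz
    refine ⟨Finset.card_pos.2 ⟨y, Finset.mem_filter.2 ⟨hy, hzy⟩⟩, ?_⟩
    refine le_trans (Finset.card_le_card (t := insert y (B.filter fun w => G.Adj y w)) ?_)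
      (Finset.card_insert_le _ _)
    intro w hw
    obtain ⟨hwB, hzw⟩ := Finset.mem_filter.1 hw
    have hw' := Finset.mem_filter.1 hwB
    rcases eq_or_ne y w with rfl | hne
    · exact Finset.mem_insert_self _ _
    · exact Finset.mem_insert_of_mem (Finset.mem_filter.2 ⟨hwB,
        hclique z hz'.1 hz'.2 y hy'.1 hy'.2 hzy w hw'.1 hw'.2 hzw hne⟩)
  have hswap : ∑ y ∈ B, ∑ z ∈ Z.filter (fun z => Solo G X c z y), (q : ℚ) / σ z =
      ∑ z ∈ Z, ∑ y ∈ B.filter (fun y => Solo G X c z y), (q : ℚ) / σ z := by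
    refine Finset.sum_comm' fun y z => ?_
    simp only [Finset.mem_filter]
    tauto
  have hupper : ∑ z ∈ Z, ∑ y ∈ B.filter (fun y => Solo G X c z y), (q : ℚ) / σ z ≤
      ∑ z ∈ Z, (q : ℚ) := by
    refine Finset.sum_le_sum fun z _ => ?_
    rw [Finset.sum_const, nsmul_eq_mul]
    change (σ z : ℚ) * _ ≤ _
    rcases Nat.eq_zero_or_pos (σ z) with h0 | h0
    · simp [h0]
    · have : (σ z : ℚ) ≠ 0 := by positivity
      rw [mul_div_cancel₀ _ this]
  have hlower : ∑ y ∈ B, (T.card : ℚ) ≤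
      ∑ y ∈ B, ∑ z ∈ Z.filter (fun z => Solo G X c z y), (q : ℚ) / σ z := by
    refine Finset.sum_le_sum fun y hy => ?_
    have h1 := hsol y hy
    have h2 := hdB y hy
    set d := degreeIn G B y
    set n := (Z.filter fun z => Solo G X c z y).card with hn
    have h3 : ∑ z ∈ Z.filter (fun z => Solo G X c z y), (q : ℚ) / (d + 1 : ℕ) ≤
        ∑ z ∈ Z.filter (fun z => Solo G X c z y), (q : ℚ) / σ z := by
      refine Finset.sum_le_sum fun z hz => ?_
      rw [Finset.mem_filter] at hz
      obtain ⟨h4, h5⟩ := hσ y hy z hz.1 hz.2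
      gcongr
    refine le_trans ?_ h3
    rw [Finset.sum_const, nsmul_eq_mul, ← hn, mul_div_assoc', le_div_iff₀ (by positivity)]
    norm_cast
    obtain ⟨e, he⟩ := Nat.exists_eq_add_of_le hlt.le
    obtain ⟨g, hg⟩ := Nat.exists_eq_add_of_le h2
    have h6 : e + (d + 1) ≤ n := by omega
    calc T.card * (d + 1) = e * (d + 1) + q * (d + 1) := by rw [he]; ring
      _ ≤ e * q + q * (d + 1) := by gcongr
      _ = (e + (d + 1)) * q := by ring
      _ ≤ n * q := by gcongr
  have hfin := (hlower.trans hswap.le).trans hupper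
  rw [Finset.sum_const, Finset.sum_const, nsmul_eq_mul, nsmul_eq_mul, hZ, hout] at hfin
  norm_cast at hfin
  nlinarith

open scoped Classical in
/-- Either `X` is equitably colorable, or more color classes can be made to reach the small class,
provided that suitable proper subsets of `X` are equitably colorable. -/
theorem equitablyColorable_or_exists_larger (h : NearlyEquitable G X K s c p m A)
    (hdeg : ∀ v ∈ X, degreeIn G X v < K.card)
    (hsub : ∀ Y ⊆ X, ∀ y ∈ X, y ∉ Y → (∃ w ∈ X, G.Adj y w) → ∀ L : Finset κ,
      Y.card = L.card * s → (∀ v ∈ Y, degreeIn G Y v < L.card) → EquitablyColorable G Y L s) :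
    EquitablyColorable G X K s ∨
      ∃ c' p' m' A', NearlyEquitable G X K s c' p' m' A' ∧ A.card < A'.card := by
  by_cases hp : p ∈ A
  · exact .inl (h.equitablyColorable hp)
  by_cases hclosed : ∀ v ∈ X, c v ∉ A → ∀ i ∈ A, ¬ Movable G X c v i
  swap
  · push Not at hclosed
    obtain ⟨v, hv, hvA, i, hi, hmov⟩ := hclosed
    refine .inr ⟨c, p, m, insert (c v) A, ⟨h.mapsTo, h.proper, h.large_mem, h.size,
      Finset.insert_subset (h.mapsTo v hv) h.subset, Finset.mem_insert_of_mem h.small_mem, ?_⟩, ?_⟩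
    · have hold : ∀ j ∈ A, PathIn (ClassArc G X c) m (insert (c v) A) j := fun j hj =>
        (h.path j hj).mono_set (Finset.subset_insert _ _)
      intro j hj
      rcases Finset.mem_insert.1 hj with rfl | hj
      · exact .head (Finset.mem_insert_self _ _) ⟨v, hv, rfl, hmov⟩ (hold i hi)
      · exact hold j hj
    · rw [Finset.card_insert_of_notMem hvA]
      exact Nat.lt_succ_self _
  obtain ⟨z, hz, hzA, hterm, hzm, y, hy, hyA, hzy, hcases⟩ := h.exists_solo hp hdeg hclosed
  have hcard := h.card_sdiff_add
  set B := X.filter fun w => c w ∉ A with hB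
  have hyB : y ∈ B := Finset.mem_filter.2 ⟨hy, hyA⟩
  have hYB : B.erase y ⊆ B := Finset.erase_subset _ _
  obtain ⟨φ, hφK, hφ, hφs⟩ := hsub (B.erase y) (hYB.trans (Finset.filter_subset _ _)) y hy
    (Finset.notMem_erase _ _) ⟨z, hz, hzy.1⟩ (K \ A)
    (by rw [Finset.card_erase_of_mem hyB, h.card_outside hp, Nat.add_sub_cancel])
    (fun v hv => (degreeIn_mono hYB v).trans_lt <|
      h.degreeIn_outside_lt hdeg hclosed (Finset.mem_filter.1 (hYB hv)).1
        (Finset.mem_filter.1 (hYB hv)).2)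
  set Y := B.erase y with hY
  have hmemY : ∀ v ∈ X, v ∉ Y → v ≠ y → c v ∈ A := by
    intro v hv hvY hvy
    by_contra hvA
    exact hvY (Finset.mem_erase.2 ⟨hvy, Finset.mem_filter.2 ⟨hv, hvA⟩⟩)
  have hYA : ∀ v ∈ Y, c v ∉ A := fun v hv => (Finset.mem_filter.1 (hYB hv)).2
  have hYX : ∀ v ∈ Y, v ∈ X := fun v hv => (Finset.mem_filter.1 (hYB hv)).1
  have hyY : y ∉ Y := Finset.notMem_erase _ _
  have hyz : y ≠ z := by
    rintro rfl
    exact hyA hzA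
  let ψ : V → κ := fun v => if v ∈ Y then φ v else if v = y then c z else c v
  have hψY : ∀ v ∈ Y, ψ v = φ v := fun v hv => if_pos hv
  have hψy : ψ y = c z := by simp only [ψ, if_neg hyY, if_pos]
  have hψc : ∀ v, v ∉ Y → v ≠ y → ψ v = c v := fun v hv hvy => by
    simp only [ψ, if_neg hv, if_neg hvy]
  have hψA : ∀ v ∈ X, v ∉ Y → ψ v ∈ A := by
    intro v hv hvY
    rcases eq_or_ne v y with rfl | hvy
    · rwa [hψy]
    · rw [hψc v hvY hvy]
      exact hmemY v hv hvY hvy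
  have hψK : ∀ v ∈ X, ψ v ∈ K := by
    intro v hv
    by_cases hvY : v ∈ Y
    · rw [hψY v hvY]
      exact (Finset.mem_sdiff.1 (hφK v hvY)).1
    · exact h.subset (hψA v hv hvY)
  have hφA : ∀ v ∈ Y, φ v ∉ A := fun v hv => (Finset.mem_sdiff.1 (hφK v hv)).2
  have hψiff : ∀ v ∈ X, v ≠ y → ∀ i ∈ A, ψ v = i ↔ c v = i := by
    intro v hv hvy i hi
    by_cases hvY : v ∈ Y
    · rw [hψY v hvY]
      exact ⟨fun he => absurd (he ▸ hi) (hφA v hvY), fun he => absurd (he ▸ hi) (hYA v hvY)⟩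
    · rw [hψc v hvY hvy]
  have hψiff' : ∀ v ∈ X, ∀ i ∈ A, i ≠ c z → (ψ v = i ↔ c v = i) := by
    intro v hv i hi hiz
    rcases eq_or_ne v y with rfl | hvy
    · rw [hψy]
      exact ⟨fun he => absurd he.symm hiz, fun he => absurd (he ▸ hi) hyA⟩
    · exact hψiff v hv hvy i hi
  have hψ : ProperOn G (X.erase z) ψ := by
    have key : ∀ w ∈ X.erase z, w ∉ Y → G.Adj y w → ψ y ≠ ψ w := by
      intro w hw hwY hyw
      obtain ⟨hwz, hwX⟩ := Finset.mem_erase.1 hw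
      rw [hψy, hψc w hwY hyw.ne']
      exact fun he => hwz (hzy.2 w hwX he.symm hyw)
    intro v hv w hw hvw
    have hvX := Finset.mem_of_mem_erase hv
    have hwX := Finset.mem_of_mem_erase hw
    by_cases hvY : v ∈ Y <;> by_cases hwY : w ∈ Y
    · rw [hψY v hvY, hψY w hwY]
      exact hφ v hvY w hwY hvw
    · rw [hψY v hvY]
      exact fun he => hφA v hvY (he ▸ hψA w hwX hwY)
    · rw [hψY w hwY]
      exact fun he => hφA w hwY (he ▸ hψA v hvX hvY)
    · rcases eq_or_ne v y with rfl | hvy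
      · exact key w hw hwY hvw
      · rcases eq_or_ne w y with rfl | hwy
        · exact (key v hv hvY hvw.symm).symm
        · rw [hψc v hvY hvy, hψc w hwY hwy]
          exact h.proper v hvX w hwX hvw
  have hψs : ∀ j ∈ K, classSize (X.erase z) ψ j + (if j = m then 1 else 0) = s := by
    intro j hj
    by_cases hjA : j ∈ A
    · have hyX : y ∈ X.erase z := Finset.mem_erase.2 ⟨hyz, hy⟩
      have h1 := classSize_erase (c := ψ) hyX j
      have h2 := classSize_erase (c := c) hyX j
      have h3 := classSize_erase (c := c) hz j
      have h4 := h.size j hj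
      have h5 : classSize ((X.erase z).erase y) ψ j = classSize ((X.erase z).erase y) c j := by
        refine classSize_congr fun v hv => ?_
        obtain ⟨hvy, hv⟩ := Finset.mem_erase.1 hv
        exact hψiff v (Finset.mem_of_mem_erase hv) hvy j hjA
      rw [hψy] at h1
      rw [if_neg (by rintro rfl; exact hyA hjA)] at h2
      rw [if_neg (c := j = p) (by rintro rfl; exact hp hjA)] at h4
      omega
    · rw [if_neg (by rintro rfl; exact hjA h.small_mem), add_zero,
        ← hφs j (Finset.mem_sdiff.2 ⟨hj, hjA⟩)]
      unfold classSize
      congr 1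
      ext v
      simp only [Finset.mem_filter, Finset.mem_erase]
      constructor
      · rintro ⟨⟨-, hvX⟩, rfl⟩
        have hvY : v ∈ Y := by
          by_contra hvY
          exact hjA (hψA v hvX hvY)
        exact ⟨hvY, (hψY v hvY).symm⟩
      · rintro ⟨hvY, rfl⟩
        refine ⟨⟨?_, hYX v hvY⟩, hψY v hvY⟩
        rintro rfl
        exact hYA v hvY hzA
  rcases hcases with ⟨i, hi, hiz, hmov⟩ | ⟨hnot, y', hy', hyA', hzy', hne, hadj⟩
  · left
    have hpath : PathIn (ClassArc G (X.erase z) ψ) m (A.erase (c z)) i := by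
      refine (hterm i hi hiz).mono subset_rfl ?_
      rintro a ha b hb ⟨w, hw, rfl, hwb⟩
      obtain ⟨haz, haA⟩ := Finset.mem_erase.1 ha
      obtain ⟨hbz, hbA⟩ := Finset.mem_erase.1 hb
      refine ⟨w, Finset.mem_erase.2 ⟨?_, hw⟩, (hψiff' w hw _ haA haz).2 rfl, fun x hx hxb => ?_⟩
      · rintro rfl
        exact haz rfl
      · have hxX := Finset.mem_of_mem_erase hx
        exact hwb x hxX ((hψiff' x hxX b hbA hbz).1 hxb)
    obtain ⟨c', hc', hout, hin, hstart, hsize⟩ := exists_shift hψ hpath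
    refine ⟨Function.update c' z i, fun v hv => ?_, hc'.update fun w hw hwi => ?_, fun j hj => ?_⟩
    · rcases eq_or_ne v z with rfl | hvz
      · rw [Function.update_self]
        exact h.subset hi
      · rw [Function.update_of_ne hvz]
        have hvX := Finset.mem_erase.2 ⟨hvz, hv⟩
        by_cases hvA : ψ v ∈ A.erase (c z)
        · exact h.subset (Finset.mem_of_mem_erase (hin v hvX hvA))
        · rw [hout v hvX hvA]
          exact hψK v hv
    · have hwX := Finset.mem_of_mem_erase hw
      exact hmov w hwX ((hψiff' w hwX i hi hiz).1 (hstart w hw hwi))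
    · rw [classSize_update hz, hsize j]
      exact hψs j hj
  · right
    have hzB : degreeIn G Y z < (K \ A).card := by
      have h1 := hdeg z hz
      rw [← sum_colorDegree_add_degreeIn (c := c) A z, ← hB] at h1
      have h2 : ∑ i ∈ A.erase (c z), 1 ≤ ∑ i ∈ A, colorDegree G X c z i := by
        refine (Finset.sum_le_sum fun i hi => ?_).trans
          (Finset.sum_le_sum_of_subset (Finset.erase_subset (c z) A))
        have hi' := Finset.mem_erase.1 hi
        exact one_le_colorDegree (hnot i hi'.2 hi'.1)
      rw [← Finset.card_eq_sum_ones, Finset.card_erase_of_mem hzA] at h2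
      have h3 : degreeIn G Y z < degreeIn G B z := by
        refine Finset.card_lt_card ((Finset.ssubset_iff_of_subset
          (Finset.filter_subset_filter _ hYB)).2 ⟨y, ?_, ?_⟩)
        · exact Finset.mem_filter.2 ⟨hyB, hzy.1.symm⟩
        · exact fun hmem => hyY (Finset.mem_filter.1 hmem).1
      have h4 : 0 < A.card := Finset.card_pos.2 ⟨_, hzA⟩
      omega
    obtain ⟨j, hj, hzj⟩ := exists_movable hφK hzB
    obtain ⟨hjK, hjA⟩ := Finset.mem_sdiff.1 hj
    have hc'z : Function.update ψ z j z = j := Function.update_self ..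
    have hc'ne : ∀ v, v ≠ z → Function.update ψ z j v = ψ v := fun v hv =>
      Function.update_of_ne hv ..
    set c' := Function.update ψ z j with hc'
    have hc'A : ∀ v, c' v ∈ A → v ≠ z := by
      rintro v hv rfl
      exact hjA (hc'z ▸ hv)
    have hy'Y : y' ∈ Y := Finset.mem_erase.2 ⟨hne.symm, Finset.mem_filter.2 ⟨hy', hyA'⟩⟩
    have hy'z : y' ≠ z := by
      rintro rfl
      exact hyA' hzA
    have hc'y' : c' y' = φ y' := by rw [hc'ne _ hy'z, hψY _ hy'Y]
    have hmovable : ∀ w, ∀ b ∈ A, b ≠ c z → Movable G X c w b → Movable G X c' w b := by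
      intro w b hb hbz hwb x hx hxb
      have hxz := hc'A x (hxb ▸ hb)
      rw [hc'ne x hxz] at hxb
      exact hwb x hx ((hψiff' x hx b hb hbz).1 hxb)
    have hpath : ∀ i ∈ A, i ≠ c z → PathIn (ClassArc G X c') m (A.erase (c z)) i := by
      intro i hi hiz
      refine (hterm i hi hiz).mono subset_rfl ?_
      rintro a ha b hb ⟨w, hw, rfl, hwb⟩
      obtain ⟨haz, haA⟩ := Finset.mem_erase.1 ha
      obtain ⟨hbz, hbA⟩ := Finset.mem_erase.1 hb
      refine ⟨w, hw, ?_, hmovable w b hbA hbz hwb⟩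
      rw [hc'ne w (by rintro rfl; exact haz rfl)]
      exact (hψiff' w hw _ haA haz).2 rfl
    have hpathz : PathIn (ClassArc G X c') m A (c z) := by
      have hold := h.path _ hzA
      generalize hW : c z = W at hold
      cases hold with
      | refl => exact absurd hW hzm
      | @step _ _ b hWA harc hp =>
        obtain ⟨hbW, hbA⟩ := Finset.mem_erase.1 hp.mem_source
        obtain ⟨w, hw, hwW, hwb⟩ := harc
        rw [← hW] at hbW hwW
        have hwz : w ≠ z := by
          rintro rfl
          exact hnot b hbA hbW hwb
        have hwy : w ≠ y := by
          rintro rfl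
          exact hyA (hwW ▸ hzA)
        refine .head hWA ⟨w, hw, ?_, hmovable w b hbA hbW hwb⟩
          ((hpath b hbA hbW).mono_set (Finset.erase_subset _ _))
        rw [hc'ne w hwz, ← hW]
        exact (hψiff w hw hwy _ hzA).2 hwW
    have hpathA : ∀ i ∈ A, PathIn (ClassArc G X c') m (insert (c' y') A) i := by
      intro i hi
      rcases eq_or_ne i (c z) with rfl | hiz
      · exact hpathz.mono_set (Finset.subset_insert _ _)
      · exact (hpath i hi hiz).mono_set
          ((Finset.erase_subset _ _).trans (Finset.subset_insert _ _))
    refine ⟨c', j, m, insert (c' y') A, ⟨fun v hv => ?_, hψ.update fun w hw hwj => ?_, hjK,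
      fun l hl => ?_, Finset.insert_subset ?_ h.subset, Finset.mem_insert_of_mem h.small_mem,
      fun l hl => ?_⟩, ?_⟩
    · rcases eq_or_ne v z with rfl | hvz
      · rwa [hc'z]
      · rw [hc'ne v hvz]
        exact hψK v hv
    · have hwX := Finset.mem_of_mem_erase hw
      have hwY : w ∈ Y := by
        by_contra hwY
        exact hjA (hwj ▸ hψA w hwX hwY)
      exact hzj w hwY (hψY w hwY ▸ hwj)
    · have h1 := hψs l hl
      rw [hc', classSize_update hz]
      omega
    · rw [hc'y']
      exact (Finset.mem_sdiff.1 (hφK y' hy'Y)).1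
    · rcases Finset.mem_insert.1 hl with rfl | hl
      · refine .head (Finset.mem_insert_self _ _) ⟨y', hy', rfl, fun x hx hxz hadj' => ?_⟩
          (hpathA _ hzA)
        have hxne := hc'A x (hxz ▸ hzA)
        rw [hc'ne x hxne] at hxz
        rcases eq_or_ne x y with rfl | hxy
        · exact hadj hadj'.symm
        · exact hxne (hzy'.2 x hx ((hψiff x hx hxy _ hzA).1 hxz) hadj')
      · exact hpathA l hl
    · rw [Finset.card_insert_of_notMem (by rw [hc'y']; exact hφA y' hy'Y)]
      exact Nat.lt_succ_self _

end NearlyEquitable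

/-- Without edges, any partition into classes of the right size will do. -/
theorem equitablyColorable_of_no_adj [Nonempty κ] (hadj : ∀ v ∈ X, ∀ w ∈ X, ¬ G.Adj v w)
    (hcard : X.card = K.card * s) : EquitablyColorable G X K s := by
  classical
  induction K using Finset.induction_on generalizing X with
  | empty =>
    have hX : X = ∅ := by simpa using hcard
    subst hX
    exact ⟨fun _ => Classical.arbitrary κ, by simp, by simp [ProperOn], by simp⟩
  | insert a K ha ih =>
    rw [Finset.card_insert_of_notMem ha, Nat.succ_mul] at hcard
    obtain ⟨Y, hYX, hY⟩ := Finset.exists_subset_card_eq (show s ≤ X.card by omega)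
    obtain ⟨c, hcK, -, hcs⟩ := ih (X := X \ Y)
      (fun v hv w hw => hadj v (Finset.sdiff_subset hv) w (Finset.sdiff_subset hw))
      (by rw [Finset.card_sdiff_of_subset hYX]; omega)
    have hca : ∀ v ∈ X, v ∉ Y → c v ∈ K := fun v hv hvY => hcK v (Finset.mem_sdiff.2 ⟨hv, hvY⟩)
    refine ⟨fun v => if v ∈ Y then a else c v, fun v hv => ?_,
      fun v hv w hw hvw => absurd hvw (hadj v hv w hw), fun i hi => ?_⟩
    · dsimp only
      split_ifs with hvY
      · exact Finset.mem_insert_self _ _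
      · exact Finset.mem_insert_of_mem (hca v hv hvY)
    · rcases Finset.mem_insert.1 hi with rfl | hiK
      · rw [← hY]
        unfold classSize
        congr 1
        ext v
        simp only [Finset.mem_filter]
        grind
      · rw [← hcs i hiK]
        unfold classSize
        congr 1
        ext v
        simp only [Finset.mem_filter, Finset.mem_sdiff]
        grind

theorem equitablyColorable_of_edges_within [Nonempty κ] (N : Finset V)
    (hN : ∀ v ∈ X, ∀ w ∈ X, G.Adj v w → v ∈ N) (hcard : X.card = K.card * s)
    (hdeg : ∀ v ∈ X, degreeIn G X v < K.card) : EquitablyColorable G X K s := by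
  classical
  induction hn : N.card using Nat.strong_induction_on generalizing N G X K with
  | _ n ih =>
    subst hn
    by_cases hadj : ∀ v ∈ X, ∀ w ∈ X, ¬ G.Adj v w
    · exact equitablyColorable_of_no_adj hadj hcard
    push Not at hadj
    obtain ⟨u, hu, w, hw, huw⟩ := hadj
    have hlt : ∀ y ∈ N, (N.erase y).card < N.card := fun y hy => Finset.card_erase_lt_of_mem hy
    obtain ⟨c, hcK, hc, hcs⟩ := ih (N.erase u).card (hlt u (hN u hu w hw huw))
      (G := G.deleteIncidenceSet u) (X := X) (K := K) (N.erase u)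
      (fun v hv w hw hvw => by
        rw [SimpleGraph.deleteIncidenceSet_adj] at hvw
        exact Finset.mem_erase.2 ⟨hvw.2.1, hN v hv w hw hvw.1⟩) hcard
      (fun v hv => (degreeIn_mono_graph (G.deleteIncidenceSet_le u) X v).trans_lt (hdeg v hv)) rfl
    have hcu : ProperOn G (X.erase u) c := by
      intro v hv w hw hvw
      rw [Finset.mem_erase] at hv hw
      exact hc v hv.2 w hw.2 ((G.deleteIncidenceSet_adj).2 ⟨hvw, hv.1, hw.1⟩)
    obtain ⟨i, hi, hmov⟩ := exists_movable (G := G) (X := X.erase u) (v := u)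
      (fun v hv => hcK v (Finset.mem_of_mem_erase hv))
      ((degreeIn_mono (Finset.erase_subset _ _) u).trans_lt (hdeg u hu))
    have hstart : NearlyEquitable G X K s (Function.update c u i) i (c u) {c u} := by
      refine ⟨fun v hv => ?_, hcu.update hmov, hi, fun j hj => ?_, ?_, by simp, ?_⟩
      · rcases eq_or_ne v u with rfl | hvu
        · rwa [Function.update_self]
        · rw [Function.update_of_ne hvu]
          exact hcK v hv
      · have h1 := classSize_erase (c := c) hu j
        rw [hcs j hj] at h1
        rw [classSize_update hu]
        omega
      · simpa using hcK u hu
      · intro j hj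
        rw [Finset.mem_singleton.1 hj]
        exact .refl (Finset.mem_singleton_self _)
    have hloop : ∀ l, ∀ (c : V → κ) (p m : κ) (A : Finset κ), NearlyEquitable G X K s c p m A →
        K.card ≤ A.card + l → EquitablyColorable G X K s := by
      intro l
      induction l with
      | zero =>
        intro c p m A h hl
        refine h.equitablyColorable ?_
        rw [Finset.eq_of_subset_of_card_le h.subset hl]
        exact h.large_mem
      | succ l ihl =>
        intro c p m A h hl
        have hsub : ∀ Y ⊆ X, ∀ y ∈ X, y ∉ Y → (∃ w ∈ X, G.Adj y w) → ∀ L : Finset κ,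
            Y.card = L.card * s → (∀ v ∈ Y, degreeIn G Y v < L.card) →
              EquitablyColorable G Y L s := by
          rintro Y hYX y hy hyY ⟨w, hw, hyw⟩ L hL hdegL
          refine ih _ (hlt y (hN y hy w hw hyw)) (N.erase y) (fun v hv w hw hvw => ?_) hL hdegL rfl
          refine Finset.mem_erase.2 ⟨?_, hN v (hYX hv) w (hYX hw) hvw⟩
          rintro rfl
          exact hyY hv
        rcases h.equitablyColorable_or_exists_larger hdeg hsub with h | ⟨c', p', m', A', h', hA⟩
        · exact h
        · exact ihl c' p' m' A' h' (by omega)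
    exact hloop K.card _ _ _ _ hstart (by omega)

/-- The **Hajnal–Szemerédi theorem** for vertex sets whose size is a multiple of the number of
colors. -/
theorem equitablyColorable_of_degreeIn_lt [Nonempty κ] (hcard : X.card = K.card * s)
    (hdeg : ∀ v ∈ X, degreeIn G X v < K.card) : EquitablyColorable G X K s :=
  equitablyColorable_of_edges_within X (fun _ hv _ _ _ => hv) hcard hdeg

/-- If every vertex of `X` has fewer than `K.card` neighbors in `X`, then `X` has a proper coloring
in which every color class has size at least `⌊X.card / K.card⌋`. -/
theorem exists_proper_div_le_classSize [Nonempty κ] (hdeg : ∀ v ∈ X, degreeIn G X v < K.card) :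
    ∃ c : V → κ, (∀ v ∈ X, c v ∈ K) ∧ ProperOn G X c ∧
      ∀ i ∈ K, X.card / K.card ≤ classSize X c i := by
  classical
  obtain ⟨X₀, hX₀, hcard⟩ := Finset.exists_subset_card_eq (Nat.mul_div_le X.card K.card)
  obtain ⟨c₀, hc₀K, hc₀, hsize⟩ := equitablyColorable_of_degreeIn_lt hcard
    fun v hv => (degreeIn_mono hX₀ v).trans_lt (hdeg v (hX₀ hv))
  obtain ⟨c, hcK, hc, hagree⟩ := exists_proper_extension hX₀ hdeg hc₀K hc₀
  refine ⟨c, hcK, hc, fun i hi => ?_⟩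
  rw [← hsize i hi]
  rw [classSize_eq_card, classSize_eq_card]
  refine Finset.card_le_card fun v hv => ?_
  rw [Finset.mem_filter] at hv ⊢
  exact ⟨hX₀ hv.1, (hagree v hv.1).trans hv.2⟩

end HajnalSzemeredi

section Triangles

/-- The conflict graph of a family of finsets: two distinct sets are adjacent if they share at least
two elements. -/
def conflictGraph (V : Type*) [DecidableEq V] : SimpleGraph (Finset V) where
  Adj T T' := T ≠ T' ∧ 2 ≤ (T ∩ T').card
  symm := ⟨fun T T' h => ⟨h.1.symm, by rw [Finset.inter_comm]; exact h.2⟩⟩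
  loopless := ⟨fun _ h => h.1 rfl⟩

variable {V : Type*} [Fintype V] [DecidableEq V] {G : SimpleGraph V} [DecidableRel G.Adj] {Δ : ℕ}

theorem degreeIn_conflictGraph_le
    (hedge : ∀ e ∈ G.edgeFinset, ((G.cliqueFinset 3).filter (fun T => e ∈ T.sym2)).card ≤ Δ)
    {T : Finset V} (hT : T ∈ G.cliqueFinset 3) :
    degreeIn (conflictGraph V) (G.cliqueFinset 3) T ≤ 3 * (Δ - 1) := by
  classical
  have hT3 := SimpleGraph.mem_cliqueFinset_iff.1 hT
  obtain ⟨a, b, c, hab, hac, hbc, rfl⟩ := SimpleGraph.is3Clique_iff.1 hT3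
  set T : Finset V := {a, b, c} with hTdef
  let F : Sym2 V → Finset (Finset V) := fun e =>
    ((G.cliqueFinset 3).filter fun T' => e ∈ T'.sym2).erase T
  have hF : ∀ x y, G.Adj x y → x ∈ T → y ∈ T → (F s(x, y)).card ≤ Δ - 1 := by
    intro x y hxy hx hy
    have hmem : T ∈ (G.cliqueFinset 3).filter fun T' => s(x, y) ∈ T'.sym2 :=
      Finset.mem_filter.2 ⟨hT, Finset.mk_mem_sym2_iff.2 ⟨hx, hy⟩⟩
    rw [Finset.card_erase_of_mem hmem]
    exact Nat.sub_le_sub_right (hedge _ (SimpleGraph.mem_edgeFinset.2 hxy)) 1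
  have hsub : ((G.cliqueFinset 3).filter fun T' => (conflictGraph V).Adj T T') ⊆
      F s(a, b) ∪ F s(a, c) ∪ F s(b, c) := by
    intro T' hT'
    obtain ⟨hT'mem, hne, hcard⟩ := Finset.mem_filter.1 hT'
    obtain ⟨x, hx, y, hy, hxy⟩ := Finset.one_lt_card.1 hcard
    simp only [Finset.mem_union, F, Finset.mem_erase, Finset.mem_filter, Finset.mk_mem_sym2_iff,
      hT'mem, hne.symm, true_and, ne_eq, not_false_eq_true]
    simp only [hTdef, Finset.mem_inter, Finset.mem_insert, Finset.mem_singleton] at hx hy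
    grind
  have h1 := hF a b hab (by simp [hTdef]) (by simp [hTdef])
  have h2 := hF a c hac (by simp [hTdef]) (by simp [hTdef])
  have h3 := hF b c hbc (by simp [hTdef]) (by simp [hTdef])
  calc degreeIn (conflictGraph V) (G.cliqueFinset 3) T
      ≤ (F s(a, b) ∪ F s(a, c) ∪ F s(b, c)).card := Finset.card_le_card hsub
    _ ≤ (F s(a, b)).card + (F s(a, c)).card + (F s(b, c)).card :=
      (Finset.card_union_le _ _).trans (Nat.add_le_add_right (Finset.card_union_le _ _) _)
    _ ≤ 3 * (Δ - 1) := by omega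

end Triangles

/-- If `G` has exactly `t` triangles and every edge lies in at most `Δ`
triangles (`Δ ≥ 1`), then the set of triangles can be partitioned into at most `3Δ − 2`
classes, each consisting of pairwise edge-disjoint triangles and of size at least
`⌊t/(3Δ − 2)⌋`.  (Two 3-cliques are edge-disjoint iff they have at most one common vertex.) -/
theorem triangles_equitable_partition
    {V : Type*} [Fintype V] [DecidableEq V]
    (G : SimpleGraph V) [DecidableRel G.Adj]
    (Δ t : ℕ) (hΔ : 1 ≤ Δ)
    (ht : (G.cliqueFinset 3).card = t)
    (hedge : ∀ e ∈ G.edgeFinset,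
      ((G.cliqueFinset 3).filter (fun T => e ∈ T.sym2)).card ≤ Δ) :
    ∃ (ℓ : ℕ) (S : Fin ℓ → Finset (Finset V)),
      ℓ ≤ 3 * Δ - 2 ∧
      (∀ i j : Fin ℓ, i ≠ j → Disjoint (S i) (S j)) ∧
      (Finset.univ.biUnion S = G.cliqueFinset 3) ∧
      (∀ i : Fin ℓ, ∀ T ∈ S i, ∀ T' ∈ S i, T ≠ T' → (T ∩ T').card ≤ 1) ∧
      (∀ i : Fin ℓ, t / (3 * Δ - 2) ≤ (S i).card) := by
  have hk : 3 * Δ - 2 = 3 * (Δ - 1) + 1 := by omega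
  have : Nonempty (Fin (3 * Δ - 2)) := ⟨⟨0, by omega⟩⟩
  obtain ⟨c, -, hc, hsize⟩ := exists_proper_div_le_classSize (G := conflictGraph V)
    (X := G.cliqueFinset 3) (K := (Finset.univ : Finset (Fin (3 * Δ - 2)))) fun T hT => by
      rw [Finset.card_univ, Fintype.card_fin, hk]
      exact Nat.lt_succ_of_le (degreeIn_conflictGraph_le hedge hT)
  refine ⟨3 * Δ - 2, fun i => (G.cliqueFinset 3).filter fun T => c T = i, le_rfl, ?_, ?_, ?_, ?_⟩
  · intro i j hij
    refine Finset.disjoint_left.2 fun T hTi hTj => hij ?_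
    rw [← (Finset.mem_filter.1 hTi).2, ← (Finset.mem_filter.1 hTj).2]
  · ext T
    simp
  · intro i T hT T' hT' hne
    rw [Finset.mem_filter] at hT hT'
    by_contra! hlt
    exact hc T hT.1 T' hT'.1 ⟨hne, hlt⟩ (hT.2.trans hT'.2.symm)
  · intro i
    have h := hsize i (Finset.mem_univ i)
    rwa [Finset.card_univ, Fintype.card_fin, ht, classSize_eq_card] at h
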